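/- arXiv:1104.5526 — 6 statements merged into one kernel-verified Lean document; each statement's English description precedes it below -/
import Mathlib

section
/- Let Λ be a semiprime ring (a ring with no nonzero nilpotent two-sided ideal) whose torsion part trs(Λ) — the set of elements of finite additive order — is finitely generated as an abelian group. Then there exists a central idempotent e ∈ Λ such that trs(Λ) = eΛ; consequently Λ decomposes as a direct product of rings Λ ≅ eΛ × (1−e)Λ, where eΛ = trs(Λ) is a torsion abelian group and (1−e)Λ ≅ Λ/trs(Λ) is torsion-free as an abelian group. -/
/-- The "corner" of a ring at an element `e`: the set of `x` with `e * x = x = x * e`.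
When `e` is a central idempotent this is precisely the two-sided ideal `eΛ`, viewed as a
non-unital ring. -/
def cornerAt {Λ : Type*} [Ring Λ] (e : Λ) : NonUnitalSubring Λ where
  carrier := {x : Λ | e * x = x ∧ x * e = x}
  zero_mem' := by simp
  add_mem' := fun ha hb => ⟨by rw [mul_add, ha.1, hb.1], by rw [add_mul, ha.2, hb.2]⟩
  neg_mem' := fun ha => ⟨by rw [mul_neg, ha.1], by rw [neg_mul, ha.2]⟩
  mul_mem' := fun {x y} hx hy =>
    ⟨by rw [← mul_assoc, hx.1], by rw [mul_assoc, hy.2]⟩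

/-- The torsion part `trs Λ` of a ring `Λ` (the set of elements of finite additive order),
as a two-sided ideal. -/
def torsionIdeal (Λ : Type*) [Ring Λ] : TwoSidedIdeal Λ :=
  TwoSidedIdeal.mk' {x : Λ | IsOfFinAddOrder x}
    (by simp [Set.mem_setOf_eq])
    (fun ha hb => ha.add hb)
    (fun ha => ha.neg)
    (fun {x y} hy => by
      obtain ⟨n, hn, h⟩ := (isOfFinAddOrder_iff_nsmul_eq_zero).1 hy
      exact (isOfFinAddOrder_iff_nsmul_eq_zero).2
        ⟨n, hn, by rw [← mul_smul_comm, h, mul_zero]⟩)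
    (fun {x y} hx => by
      obtain ⟨n, hn, h⟩ := (isOfFinAddOrder_iff_nsmul_eq_zero).1 hx
      exact (isOfFinAddOrder_iff_nsmul_eq_zero).2
        ⟨n, hn, by rw [← smul_mul_assoc, h, zero_mul]⟩)

theorem aux_semi {Λ : Type*} [Ring Λ]
    (hs : ∀ I : TwoSidedIdeal Λ, (∀ x ∈ I, ∀ y ∈ I, x * y = 0) → I = ⊥)
    (a : Λ) (ha : ∀ l, a * l * a = 0) : a = 0 := by
  let S : AddSubgroup Λ := AddSubgroup.closure {x | ∃ l r, x = l * a * r}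
  have hl : ∀ l x, x ∈ S → l * x ∈ S := by
    intro l x hx
    induction hx using AddSubgroup.closure_induction with
    | mem x hx =>
      obtain ⟨p, q, rfl⟩ := hx
      exact AddSubgroup.subset_closure ⟨l * p, q, by simp only [mul_assoc]⟩
    | zero => rw [mul_zero]; exact S.zero_mem
    | add x y _ _ h1 h2 => rw [mul_add]; exact S.add_mem h1 h2
    | neg x _ h => rw [mul_neg]; exact S.neg_mem h
  have hr : ∀ l x, x ∈ S → x * l ∈ S := by
    intro l x hx
    induction hx using AddSubgroup.closure_induction with
    | mem x hx =>
      obtain ⟨p, q, rfl⟩ := hx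
      exact AddSubgroup.subset_closure ⟨p, q * l, by simp only [mul_assoc]⟩
    | zero => rw [zero_mul]; exact S.zero_mem
    | add x y _ _ h1 h2 => rw [add_mul]; exact S.add_mem h1 h2
    | neg x _ h => rw [neg_mul]; exact S.neg_mem h
  have hz : ∀ x ∈ S, ∀ y ∈ S, x * y = 0 := by
    intro x hx y hy
    induction hx using AddSubgroup.closure_induction with
    | mem x hx =>
      obtain ⟨p, q, rfl⟩ := hx
      induction hy using AddSubgroup.closure_induction with
      | mem y hy =>
        obtain ⟨p', q', rfl⟩ := hy
        have h := ha (q * p')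
        calc p * a * q * (p' * a * q') = p * (a * (q * p') * a) * q' := by
              simp only [mul_assoc]
          _ = 0 := by rw [h, mul_zero, zero_mul]
      | zero => rw [mul_zero]
      | add x y _ _ h1 h2 => rw [mul_add, h1, h2, add_zero]
      | neg x _ h => rw [mul_neg, h, neg_zero]
    | zero => rw [zero_mul]
    | add x y _ _ h1 h2 => rw [add_mul, h1, h2, add_zero]
    | neg x _ h => rw [neg_mul, h, neg_zero]
  let I : TwoSidedIdeal Λ := TwoSidedIdeal.mk' (S : Set Λ) S.zero_mem
    (fun h1 h2 => S.add_mem h1 h2) (fun h => S.neg_mem h)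
    (fun {x y} h => hl x y h) (fun {x y} h => hr y x h)
  have hI : ∀ x, x ∈ I ↔ x ∈ S := fun x => by
    simp only [I, TwoSidedIdeal.mem_mk', SetLike.mem_coe]
  have hb := hs I (fun x hx y hy => hz x ((hI x).1 hx) y ((hI y).1 hy))
  have haI : a ∈ I := (hI a).2 (AddSubgroup.subset_closure ⟨1, 1, by simp⟩)
  rw [hb] at haI
  simpa using haI

theorem aux_idem {Λ : Type*} [Ring Λ]
    (hs : ∀ a : Λ, (∀ l, a * l * a = 0) → a = 0) (n : ℕ) :
    ∀ R : AddSubgroup Λ, (R : Set Λ).Finite → (R : Set Λ).ncard ≤ n →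
      (∀ x ∈ R, ∀ l, x * l ∈ R) → (∃ x ∈ R, x ≠ 0) →
      ∃ f ∈ R, f ≠ 0 ∧ f * f = f := by
  induction n with
  | zero =>
    intro R hf hc _ _
    have := (Set.ncard_eq_zero hf).1 (Nat.le_zero.1 hc)
    exact absurd (this ▸ R.zero_mem : (0:Λ) ∈ (∅ : Set Λ)) (by simp)
  | succ n ih =>
    intro R hf hc hR hne
    have key : ∀ R' : AddSubgroup Λ, R' ≤ R → (∃ x ∈ R, x ∉ R') →
        (∀ x ∈ R', ∀ l, x * l ∈ R') → (∃ x ∈ R', x ≠ 0) →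
        ∃ f ∈ R, f ≠ 0 ∧ f * f = f := by
      rintro R' hle ⟨x, hx, hx'⟩ h1 h2
      have hlt : (R' : Set Λ).ncard < (R : Set Λ).ncard :=
        Set.ncard_lt_ncard ⟨hle, fun h => hx' (h hx)⟩ hf
      obtain ⟨f, hf1, hf2⟩ := ih R' (hf.subset hle) (by omega) h1 h2
      exact ⟨f, hle hf1, hf2⟩
    obtain ⟨a, haR, r, hrR, har⟩ : ∃ a ∈ R, ∃ r ∈ R, a * r ≠ 0 := by
      by_contra! h
      obtain ⟨x, hx, hx0⟩ := hne
      exact hx0 (hs x fun l => h _ (hR x hx l) _ hx)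
    by_cases h1 : ∃ x ∈ R, x ∉ R.map (AddMonoidHom.mulLeft a)
    · refine key _ ?_ h1 ?_ ⟨a * r, ⟨r, hrR, rfl⟩, har⟩
      · rintro _ ⟨y, hy, rfl⟩
        exact hR a haR y
      · rintro _ ⟨y, hy, rfl⟩ l
        exact ⟨y * l, hR y hy l, by simp [mul_assoc]⟩
    by_cases h2 : ∃ x ∈ R, x ≠ 0 ∧ a * x = 0
    · obtain ⟨x, hx, hx0, hax⟩ := h2
      refine key (R ⊓ (AddMonoidHom.mulLeft a).ker) inf_le_left ⟨r, hrR, fun h => har h.2⟩ ?_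
        ⟨x, ⟨hx, hax⟩, hx0⟩
      rintro y ⟨hy, hy2⟩ l
      have hy3 : a * y = 0 := hy2
      refine ⟨hR y hy l, ?_⟩
      change a * (y * l) = 0
      rw [← mul_assoc, hy3, zero_mul]
    push Not at h1 h2
    obtain ⟨f, hfR, hfa⟩ := h1 a haR
    have hfa : a * f = a := hfa
    refine ⟨f, hfR, ?_, ?_⟩
    · rintro rfl
      rw [mul_zero] at hfa
      exact har (by rw [← hfa, zero_mul])
    · by_contra hff
      refine h2 (f * f - f) (R.sub_mem (hR f hfR f) hfR) (sub_ne_zero.2 hff) ?_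
      rw [mul_sub, ← mul_assoc, hfa, hfa, sub_self]

theorem aux_left {Λ : Type*} [Ring Λ]
    (hs : ∀ a : Λ, (∀ l, a * l * a = 0) → a = 0) (T : AddSubgroup Λ)
    (hT : (T : Set Λ).Finite) (hr : ∀ x ∈ T, ∀ l, x * l ∈ T) (n : ℕ) :
    ∀ e ∈ T, e * e = e →
      ((T ⊓ (AddMonoidHom.mulLeft e).ker : AddSubgroup Λ) : Set Λ).ncard ≤ n →
      ∃ e ∈ T, e * e = e ∧ ∀ x ∈ T, e * x = x := by
  induction n with
  | zero =>
    intro e _ _ hc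
    have := (Set.ncard_eq_zero (hT.subset (fun x hx => hx.1))).1 (Nat.le_zero.1 hc)
    exact absurd (this ▸ AddSubgroup.zero_mem _ : (0:Λ) ∈ (∅ : Set Λ)) (by simp)
  | succ n ih =>
    intro e he hee hc
    by_cases h : ∀ x ∈ T, e * x = 0 → x = 0
    · refine ⟨e, he, hee, fun x hx => ?_⟩
      have := h (e * x - x) (T.sub_mem (hr e he x) hx)
        (by rw [mul_sub, ← mul_assoc, hee, sub_self])
      exact sub_eq_zero.1 this
    push Not at h
    obtain ⟨x, hx, hex, hx0⟩ := h
    have hfin : ((T ⊓ (AddMonoidHom.mulLeft e).ker : AddSubgroup Λ) : Set Λ).Finite :=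
      hT.subset (fun x hx => hx.1)
    obtain ⟨f, ⟨hfT, hfe⟩, hf0, hff⟩ := aux_idem hs _ (T ⊓ (AddMonoidHom.mulLeft e).ker)
      hfin le_rfl (by
        rintro y ⟨hy, hy2⟩ l
        have hy3 : e * y = 0 := hy2
        refine ⟨hr y hy l, ?_⟩
        change e * (y * l) = 0
        rw [← mul_assoc, hy3, zero_mul]) ⟨x, ⟨hx, hex⟩, hx0⟩
    have hef : e * f = 0 := hfe
    have heg : e * (e + f - f * e) = e := by
      rw [mul_sub, mul_add, hee, ← mul_assoc, hef, zero_mul, add_zero, sub_zero]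
    have hfg : f * (e + f - f * e) = f := by
      rw [mul_sub, mul_add, ← mul_assoc, hff]; abel
    refine ih (e + f - f * e) (T.sub_mem (T.add_mem he hfT) (hr f hfT e)) ?_ ?_
    · rw [sub_mul, add_mul, heg, hfg, mul_assoc, heg]
    · refine Nat.le_of_lt_succ (lt_of_lt_of_le (Set.ncard_lt_ncard ⟨?_, ?_⟩ hfin) hc)
      · rintro y ⟨hy, hy2⟩
        have hy3 : (e + f - f * e) * y = 0 := hy2
        refine ⟨hy, ?_⟩
        change e * y = 0
        rw [← heg, mul_assoc, hy3, mul_zero]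
      · intro hsub
        have h3 : (e + f - f * e) * f = 0 := (hsub ⟨hfT, hfe⟩).2
        rw [sub_mul, add_mul, hef, hff, mul_assoc, hef, mul_zero, zero_add, sub_zero] at h3
        exact hf0 h3

/-- Let `Λ` be a semiprime ring (no nonzero two-sided ideal squaring to zero)
whose torsion part `trs Λ` is finitely generated as an abelian group. Then there is a central
idempotent `e` with `trs Λ = eΛ`; consequently `Λ ≅ eΛ × (1-e)Λ` as rings, where
`eΛ = trs Λ` is torsion and `(1-e)Λ ≅ Λ / trs Λ` is torsion-free. -/
theorem stmt0 {Λ : Type*} [Ring Λ]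
    (hsemiprime : ∀ I : TwoSidedIdeal Λ, (∀ x ∈ I, ∀ y ∈ I, x * y = 0) → I = ⊥)
    (hfg : (AddCommGroup.torsion Λ).FG) :
    ∃ e : Λ, IsIdempotentElem e ∧ e ∈ Subring.center Λ ∧
      ({x : Λ | IsOfFinAddOrder x} = {x : Λ | ∃ l : Λ, x = e * l}) ∧
      (∀ x ∈ cornerAt e, IsOfFinAddOrder x) ∧
      (∀ x ∈ cornerAt (1 - e), IsOfFinAddOrder x → x = 0) ∧
      Nonempty (Λ ≃+* (cornerAt e × cornerAt (1 - e))) ∧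
      Nonempty ((cornerAt (1 - e) : NonUnitalSubring Λ) ≃+*
        (torsionIdeal Λ).ringCon.Quotient) := by
  have hs := aux_semi hsemiprime
  let T : AddSubgroup Λ := AddCommGroup.torsion Λ
  have hmem : ∀ x, x ∈ T ↔ IsOfFinAddOrder x := fun x => Iff.rfl
  have hr : ∀ x ∈ T, ∀ l, x * l ∈ T := by
    intro x hx l
    obtain ⟨n, hn, h⟩ := (isOfFinAddOrder_iff_nsmul_eq_zero).1 hx
    exact (isOfFinAddOrder_iff_nsmul_eq_zero).2
        ⟨n, hn, by rw [← smul_mul_assoc, h, zero_mul]⟩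
  have hl : ∀ x ∈ T, ∀ l, l * x ∈ T := by
    intro x hx l
    obtain ⟨n, hn, h⟩ := (isOfFinAddOrder_iff_nsmul_eq_zero).1 hx
    exact (isOfFinAddOrder_iff_nsmul_eq_zero).2
        ⟨n, hn, by rw [← mul_smul_comm, h, mul_zero]⟩
  have hfin : (T : Set Λ).Finite := by
    have : AddGroup.FG T := (AddGroup.fg_iff_addSubgroup_fg T).2 hfg
    have ht : AddMonoid.IsTorsion T := by
      rintro ⟨x, hx⟩
      exact (AddSubmonoid.isOfFinAddOrder_coe (H := T.toAddSubmonoid)).1 hx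
    have := AddCommGroup.finite_of_fg_torsion T ht
    exact Set.toFinite _
  obtain ⟨e, heT, hee, hel⟩ := aux_left hs T hfin hr _ 0 T.zero_mem (mul_zero 0) le_rfl
  have her : ∀ x ∈ T, x * e = x := by
    intro x hx
    refine sub_eq_zero.1 (hs _ fun l => ?_)
    have h2 : l * (x * e - x) ∈ T := hl _ (T.sub_mem (hr x hx e) hx) l
    rw [mul_assoc, sub_mul, mul_assoc, hel _ h2, sub_self]
  have hcen : ∀ l, l * e = e * l := fun l => by
    rw [← hel _ (hl e heT l), ← mul_assoc, her _ (hr e heT l)]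
  have hcor : ∀ x, x ∈ cornerAt e ↔ e * x = x ∧ x * e = x := fun x => Iff.rfl
  have hcor' : ∀ x, x ∈ cornerAt (1 - e) ↔ e * x = 0 := fun x => by
    change (1 - e) * x = x ∧ x * (1 - e) = x ↔ _
    rw [sub_mul, mul_sub, one_mul, mul_one, hcen, and_self, sub_eq_self]
  have hx1 : ∀ x, e * x ∈ cornerAt e := fun x => by
    rw [hcor, mul_assoc, hcen x, ← mul_assoc, hee, and_self]
  have hx2 : ∀ x, x - e * x ∈ cornerAt (1 - e) := fun x => by
    rw [hcor', mul_sub, ← mul_assoc, hee, sub_self]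
  refine ⟨e, hee, Subring.mem_center_iff.2 hcen, ?_, ?_, ?_, ?_, ?_⟩
  · ext x
    exact ⟨fun hx => ⟨x, (hel x hx).symm⟩, by rintro ⟨l, rfl⟩; exact hr e heT l⟩
  · intro x hx
    rw [← hx.1]
    exact hr e heT x
  · intro x hx hx'
    rw [← hel x hx', (hcor' x).1 hx]
  · refine ⟨{ toFun := fun x => (⟨e * x, hx1 x⟩, ⟨x - e * x, hx2 x⟩)
              invFun := fun p => p.1 + p.2
              left_inv := fun x => by simp
              right_inv := ?_
              map_mul' := ?_
              map_add' := ?_ }⟩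
    · rintro ⟨⟨a, ha⟩, ⟨b, hb⟩⟩
      have h1 := ha.1
      have h2 := (hcor' b).1 hb
      ext
      · simp [mul_add, h1, h2]
      · simp [mul_add, h1, h2]
    · intro x y
      have h1 : e * x * (e * y) = e * (x * y) := by
        rw [← mul_assoc, mul_assoc e x e, hcen x, ← mul_assoc, hee, mul_assoc]
      have h2 : x * (e * y) = e * (x * y) := by
        rw [← mul_assoc, hcen x, mul_assoc]
      ext
      · exact h1.symm
      · change x * y - e * (x * y) = (x - e * x) * (y - e * y)
        rw [sub_mul, mul_sub, mul_sub, h1, h2, mul_assoc]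
        abel
    · intro x y
      ext
      · exact mul_add e x y
      · change x + y - e * (x + y) = (x - e * x) + (y - e * y)
        rw [mul_add]
        abel
  · have hti : ∀ x, x ∈ torsionIdeal Λ ↔ x ∈ T := fun x => by
      simp only [torsionIdeal, TwoSidedIdeal.mem_mk', Set.mem_setOf_eq, hmem]
    let φ : cornerAt (1 - e) →ₙ+* (torsionIdeal Λ).ringCon.Quotient :=
      { toFun := fun x => ((x : Λ) : (torsionIdeal Λ).ringCon.Quotient)
        map_mul' := fun x y => rfl
        map_add' := fun x y => rfl
        map_zero' := rfl }
    refine ⟨RingEquiv.ofBijective φ ⟨?_, ?_⟩⟩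
    · rintro ⟨x, hx⟩ ⟨y, hy⟩ hxy
      have h := (RingCon.eq _).1 hxy
      rw [TwoSidedIdeal.rel_iff, hti] at h
      have h2 := hel _ h
      change e * (x - y) = x - y at h2
      rw [mul_sub, (hcor' x).1 hx, (hcor' y).1 hy, sub_zero] at h2
      exact Subtype.ext (sub_eq_zero.1 h2.symm)
    · intro q
      obtain ⟨x, rfl⟩ := Quotient.exists_rep q
      refine ⟨⟨x - e * x, hx2 x⟩, (RingCon.eq _).2 ?_⟩
      rw [TwoSidedIdeal.rel_iff, hti]
      change x - e * x - x ∈ T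
      rw [sub_sub_cancel_left]
      exact T.neg_mem (hr e heT x)
end

section
/- Let Λ be a semiprime ring (a ring with no nonzero nilpotent two-sided ideal) and let I be a two-sided ideal of Λ whose underlying additive group is finite. Then I = eΛ for some idempotent e ∈ Λ. -/
theorem sq_zero_aux {Λ : Type*} [Ring Λ]
    (hs : ∀ J : TwoSidedIdeal Λ, (∀ x ∈ J, ∀ y ∈ J, x * y = 0) → J = ⊥)
    (M : AddSubgroup Λ) (hM : ∀ x ∈ M, ∀ l : Λ, x * l ∈ M)
    (h0 : ∀ x ∈ M, ∀ y ∈ M, x * y = 0) : ∀ x ∈ M, x = 0 := by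
  let S : Set Λ := {z | ∃ l : Λ, ∃ m ∈ M, z = l * m}
  let C := AddSubgroup.closure S
  have hl : ∀ {x y : Λ}, y ∈ C → x * y ∈ C := by
    intro x y hy
    induction hy using AddSubgroup.closure_induction with
    | mem z hz =>
      obtain ⟨l, m, hm, rfl⟩ := hz
      exact AddSubgroup.subset_closure ⟨x * l, m, hm, by rw [mul_assoc]⟩
    | zero => simp
    | add a b _ _ ha hb => rw [mul_add]; exact C.add_mem ha hb
    | neg a _ ha => rw [mul_neg]; exact C.neg_mem ha
  have hr : ∀ {x y : Λ}, x ∈ C → x * y ∈ C := by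
    intro x y hx
    induction hx using AddSubgroup.closure_induction with
    | mem z hz =>
      obtain ⟨l, m, hm, rfl⟩ := hz
      exact AddSubgroup.subset_closure ⟨l, m * y, hM m hm y, by rw [mul_assoc]⟩
    | zero => simp
    | add a b _ _ ha hb => rw [add_mul]; exact C.add_mem ha hb
    | neg a _ ha => rw [neg_mul]; exact C.neg_mem ha
  have h1 : ∀ m ∈ M, ∀ y ∈ C, m * y = 0 := by
    intro m hm y hy
    induction hy using AddSubgroup.closure_induction with
    | mem z hz =>
      obtain ⟨l, m', hm', rfl⟩ := hz
      rw [← mul_assoc]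
      exact h0 _ (hM m hm l) _ hm'
    | zero => simp
    | add a b _ _ ha hb => rw [mul_add, ha, hb, add_zero]
    | neg a _ ha => rw [mul_neg, ha, neg_zero]
  have h2 : ∀ x ∈ C, ∀ y ∈ C, x * y = 0 := by
    intro x hx y hy
    induction hx using AddSubgroup.closure_induction with
    | mem z hz =>
      obtain ⟨l, m', hm', rfl⟩ := hz
      rw [mul_assoc, h1 _ hm' _ hy, mul_zero]
    | zero => simp
    | add a b _ _ ha hb => rw [add_mul, ha, hb, add_zero]
    | neg a _ ha => rw [neg_mul, ha, neg_zero]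
  let J : TwoSidedIdeal Λ := TwoSidedIdeal.mk' (C : Set Λ) C.zero_mem
    (fun h h' => C.add_mem h h') (fun h => C.neg_mem h) hl hr
  have hJ : ∀ x, x ∈ J ↔ x ∈ C := fun x => by
    simp [J, TwoSidedIdeal.mem_mk']
  have := hs J (fun x hx y hy => h2 x ((hJ x).1 hx) y ((hJ y).1 hy))
  intro x hx
  have hxJ : x ∈ J := (hJ x).2 (AddSubgroup.subset_closure ⟨1, x, hx, by simp⟩)
  rw [this] at hxJ
  simpa using hxJ

theorem idem_aux {Λ : Type*} [Ring Λ]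
    (hs : ∀ J : TwoSidedIdeal Λ, (∀ x ∈ J, ∀ y ∈ J, x * y = 0) → J = ⊥) (n : ℕ) :
    ∀ (M : AddSubgroup Λ), (∀ x ∈ M, ∀ l : Λ, x * l ∈ M) → (M : Set Λ).Finite →
      (M : Set Λ).ncard = n → (∃ x ∈ M, x ≠ 0) → ∃ f ∈ M, f * f = f ∧ f ≠ 0 := by
  induction n using Nat.strong_induction_on with
  | _ n ih =>
  intro M hM hfin hn hne
  have hab : ∃ a ∈ M, ∃ b ∈ M, a * b ≠ 0 := by
    by_contra! h
    obtain ⟨x, hx, hx0⟩ := hne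
    exact hx0 (sq_zero_aux hs M hM h x hx)
  obtain ⟨a, ha, b, hb, hab⟩ := hab
  have key : ∀ N : AddSubgroup Λ, N ≤ M → (∀ x ∈ N, ∀ l : Λ, x * l ∈ N) →
      (∃ x ∈ N, x ≠ 0) → (∃ x ∈ M, x ∉ N) → ∃ f ∈ M, f * f = f ∧ f ≠ 0 := by
    intro N hNM hN hN0 ⟨x, hx, hxN⟩
    have hlt : (N : Set Λ).ncard < n := by
      rw [← hn]
      exact Set.ncard_lt_ncard ⟨hNM, fun h => hxN (h hx)⟩ hfin
    obtain ⟨f, hf, h⟩ := ih _ hlt N hN (hfin.subset hNM) rfl hN0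
    exact ⟨f, hNM hf, h⟩
  by_cases h1 : ∃ f ∈ M, a * f = a
  · obtain ⟨f, hf, haf⟩ := h1
    by_cases h2 : ∃ x ∈ M, a * x = 0 ∧ x ≠ 0
    · obtain ⟨x, hx, hax, hx0⟩ := h2
      refine key (M ⊓ (AddMonoidHom.mulLeft a).ker) inf_le_left ?_ ⟨x, ⟨hx, hax⟩, hx0⟩
        ⟨b, hb, fun h => hab h.2⟩
      rintro y ⟨hy, hay⟩ l
      refine ⟨hM y hy l, ?_⟩
      change a * (y * l) = 0
      rw [← mul_assoc, show a * y = 0 from hay, zero_mul]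
    · push Not at h2
      refine ⟨f, hf, ?_, ?_⟩
      · have := h2 (f * f - f) (M.sub_mem (hM f hf f) hf)
          (by rw [mul_sub, ← mul_assoc, haf, haf, sub_self])
        exact sub_eq_zero.1 this
      · rintro rfl
        rw [mul_zero] at haf
        exact hab (by rw [← haf, zero_mul])
  · refine key (M.map (AddMonoidHom.mulLeft a)) ?_ ?_ ⟨a * b, ⟨b, hb, rfl⟩, hab⟩
      ⟨a, ha, fun ⟨f, hf, h⟩ => h1 ⟨f, hf, h⟩⟩
    · rintro _ ⟨y, hy, rfl⟩
      exact hM a ha y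
    · rintro _ ⟨y, hy, rfl⟩ l
      exact ⟨y * l, hM y hy l, (mul_assoc a y l).symm⟩

theorem unit_aux {Λ : Type*} [Ring Λ]
    (hs : ∀ J : TwoSidedIdeal Λ, (∀ x ∈ J, ∀ y ∈ J, x * y = 0) → J = ⊥)
    (I : TwoSidedIdeal Λ) (hfin : (I : Set Λ).Finite) (n : ℕ) :
    ∀ e ∈ I, e * e = e → {x : Λ | x ∈ I ∧ e * x = 0}.ncard = n →
      ∃ e' ∈ I, e' * e' = e' ∧ ∀ x ∈ I, e' * x = x := by
  induction n using Nat.strong_induction_on with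
  | _ n ih =>
  intro e he hee hn
  by_cases h : ∃ x ∈ I, e * x = 0 ∧ x ≠ 0
  · obtain ⟨x, hx, hex, hx0⟩ := h
    let K : AddSubgroup Λ :=
      { carrier := {x : Λ | x ∈ I ∧ e * x = 0}
        zero_mem' := ⟨I.zero_mem, mul_zero _⟩
        add_mem' := fun {a b} ha hb => ⟨I.add_mem ha.1 hb.1, by rw [mul_add, ha.2, hb.2, add_zero]⟩
        neg_mem' := fun {a} ha => ⟨I.neg_mem ha.1, by rw [mul_neg, ha.2, neg_zero]⟩ }
    have hKfin : (K : Set Λ).Finite := hfin.subset fun y hy => hy.1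
    obtain ⟨f, ⟨hfI, hef⟩, hff, hf0⟩ := idem_aux hs _ K
      (fun y hy l => ⟨I.mul_mem_right _ _ hy.1, by rw [← mul_assoc, hy.2, zero_mul]⟩)
      hKfin rfl ⟨x, ⟨hx, hex⟩, hx0⟩
    have e1 : (e + f - f * e) * e = e := by
      rw [sub_mul, add_mul, mul_assoc, hee]; abel
    have e2 : (e + f - f * e) * f = f := by
      rw [sub_mul, add_mul, mul_assoc, hef, hff]; simp
    have e3 : e * (e + f - f * e) = e := by
      rw [mul_sub, mul_add, ← mul_assoc, hef, hee]; simp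
    have e4 : f * (e + f - f * e) = f := by
      rw [mul_sub, mul_add, ← mul_assoc, hff]; abel
    refine ih _ ?_ (e + f - f * e)
      (I.sub_mem (I.add_mem he hfI) (I.mul_mem_right _ _ hfI)) ?_ rfl
    · rw [← hn]
      refine Set.ncard_lt_ncard ⟨?_, fun hh => ?_⟩ hKfin
      · rintro y ⟨hy, hy0⟩
        refine ⟨hy, ?_⟩
        rw [← e3, mul_assoc, hy0, mul_zero]
      · have := (hh ⟨hfI, hef⟩).2
        rw [e2] at this
        exact hf0 this
    · conv_lhs => rw [mul_sub, mul_add, ← mul_assoc, e1, e2]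
  · push Not at h
    refine ⟨e, he, hee, fun x hx => ?_⟩
    have := h (x - e * x) (I.sub_mem hx (I.mul_mem_left _ _ hx))
      (by rw [mul_sub, ← mul_assoc, hee, sub_self])
    exact (sub_eq_zero.1 this).symm


/-- Let `Λ` be a semiprime ring (no nonzero two-sided ideal `I` with
`I * I = 0`) and let `I` be a two-sided ideal of `Λ` whose underlying additive group is
finite. Then `I = eΛ` for some idempotent `e ∈ Λ`. -/
theorem stmt1 {Λ : Type*} [Ring Λ]
    (hsemiprime : ∀ J : TwoSidedIdeal Λ, (∀ x ∈ J, ∀ y ∈ J, x * y = 0) → J = ⊥)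
    (I : TwoSidedIdeal Λ) (hfin : (I : Set Λ).Finite) :
    ∃ e : Λ, IsIdempotentElem e ∧ (I : Set Λ) = {x : Λ | ∃ l : Λ, x = e * l} := by

  obtain ⟨e, he, hee, h⟩ := unit_aux hsemiprime I hfin _ 0 I.zero_mem (mul_zero 0) rfl
  refine ⟨e, hee, Set.ext fun x => ⟨fun hx => ⟨x, (h x hx).symm⟩, ?_⟩⟩
  rintro ⟨l, rfl⟩
  exact I.mul_mem_right _ _ he
end

section
/- For every r ≥ 1 and every integer m ≥ 1, the image of the reduction homomorphism GL(r, ℤ) → GL(r, ℤ/mℤ), induced by the canonical ring homomorphism ℤ → ℤ/mℤ applied entrywise, is exactly the set of matrices A ∈ GL(r, ℤ/mℤ) whose determinant is 1 or −1. In particular the image contains SL(r, ℤ/mℤ). -/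
/-- `A` lifts to an integer matrix of determinant one. -/
def LiftsSL {m : ℕ} {n : Type} [Fintype n] [DecidableEq n] (A : Matrix n n (ZMod m)) : Prop :=
  ∃ B : Matrix n n ℤ, B.det = 1 ∧ (Int.castRingHom (ZMod m)).mapMatrix B = A

theorem LiftsSL.mul {m : ℕ} {n : Type} [Fintype n] [DecidableEq n] {A B : Matrix n n (ZMod m)}
    (hA : LiftsSL A) (hB : LiftsSL B) : LiftsSL (A * B) := by
  obtain ⟨A', h1, rfl⟩ := hA
  obtain ⟨B', h2, rfl⟩ := hB
  exact ⟨A' * B', by simp [h1, h2], by rw [map_mul]⟩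

theorem exists_lift_rect {m : ℕ} {n k : Type} (A : Matrix n k (ZMod m)) :
    ∃ B : Matrix n k ℤ, B.map (Int.castRingHom (ZMod m)) = A := by
  choose f hf using ZMod.intCast_surjective (n := m)
  refine ⟨A.map f, ?_⟩
  ext i j
  simp [hf]

theorem liftsSL_upper {m : ℕ} {n : Type} [Fintype n] [DecidableEq n]
    (x : Matrix Unit n (ZMod m)) : LiftsSL (Matrix.fromBlocks 1 x 0 1) := by
  obtain ⟨x', rfl⟩ := exists_lift_rect x
  refine ⟨Matrix.fromBlocks 1 x' 0 1, by simp, ?_⟩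
  rw [RingHom.mapMatrix_apply, Matrix.fromBlocks_map]
  simp [Matrix.map_one, Matrix.map_zero]

theorem liftsSL_lower {m : ℕ} {n : Type} [Fintype n] [DecidableEq n]
    (x : Matrix n Unit (ZMod m)) : LiftsSL (Matrix.fromBlocks 1 0 x 1) := by
  obtain ⟨x', rfl⟩ := exists_lift_rect x
  refine ⟨Matrix.fromBlocks 1 0 x' 1, by simp, ?_⟩
  rw [RingHom.mapMatrix_apply, Matrix.fromBlocks_map]
  simp [Matrix.map_one, Matrix.map_zero]

theorem liftsSL_diag {m : ℕ} {n : Type} [Fintype n] [DecidableEq n]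
    {D : Matrix n n (ZMod m)} (hD : LiftsSL D) :
    LiftsSL (Matrix.fromBlocks (1 : Matrix Unit Unit (ZMod m)) 0 0 D) := by
  obtain ⟨D', h, rfl⟩ := hD
  refine ⟨Matrix.fromBlocks 1 0 0 D', by simp [h], ?_⟩
  rw [RingHom.mapMatrix_apply, Matrix.fromBlocks_map]
  simp [Matrix.map_one, Matrix.map_zero]

theorem liftsSL_of_upper {m : ℕ} {n : Type} [Fintype n] [DecidableEq n]
    (x : Matrix Unit n (ZMod m)) {A : Matrix (Unit ⊕ n) (Unit ⊕ n) (ZMod m)}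
    (h : LiftsSL (Matrix.fromBlocks 1 x 0 1 * A)) : LiftsSL A := by
  have := (liftsSL_upper (-x)).mul h
  rw [← mul_assoc, Matrix.fromBlocks_multiply] at this
  simpa using this

theorem liftsSL_of_lower {m : ℕ} {n : Type} [Fintype n] [DecidableEq n]
    (x : Matrix n Unit (ZMod m)) {A : Matrix (Unit ⊕ n) (Unit ⊕ n) (ZMod m)}
    (h : LiftsSL (Matrix.fromBlocks 1 0 x 1 * A)) : LiftsSL A := by
  have := (liftsSL_lower (-x)).mul h
  rw [← mul_assoc, Matrix.fromBlocks_multiply] at this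
  simpa using this

theorem stable_rank_zmod {m : ℕ} (hm : 1 ≤ m) (a s c : ZMod m) (h : a * c + s = 1) :
    ∃ x : ZMod m, IsUnit (a + x * s) := by
  have : NeZero m := ⟨by omega⟩
  classical
  let P := m.primeFactors.filter (fun p => ¬ p ∣ a.val)
  refine ⟨((∏ p ∈ P, p : ℕ) : ZMod m), ?_⟩
  have e : a + ((∏ p ∈ P, p : ℕ) : ZMod m) * s
      = ((a.val + (∏ p ∈ P, p) * s.val : ℕ) : ZMod m) := by
    push_cast
    simp
  rw [e, ZMod.isUnit_iff_coprime]
  apply Nat.Coprime.symm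
  apply Nat.coprime_of_dvd
  intro p hp hpm hpd
  have hpP : p ∈ m.primeFactors := Nat.mem_primeFactors.2 ⟨hp, hpm, by omega⟩
  by_cases hpa : p ∣ a.val
  · have h1 : p ∣ (∏ p ∈ P, p) * s.val := (Nat.dvd_add_right hpa).1 hpd
    rcases (Nat.Prime.dvd_mul hp).1 h1 with h2 | h2
    · obtain ⟨q, hq, hpq⟩ := (hp.prime.dvd_finsetProd_iff _).1 h2
      have hq' := Finset.mem_filter.1 hq
      have : p = q := (Nat.prime_dvd_prime_iff_eq hp (Nat.prime_of_mem_primeFactors hq'.1)).1 hpq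
      subst this
      exact hq'.2 hpa
    · have h3 : ((a.val * c.val + s.val : ℕ) : ZMod m) = ((1 : ℕ) : ZMod m) := by
        push_cast
        simpa using h
      rw [ZMod.natCast_eq_natCast_iff] at h3
      have h4 : a.val * c.val + s.val ≡ 1 [MOD p] := h3.of_dvd hpm
      have h5 : p ∣ a.val * c.val + s.val := dvd_add (dvd_mul_of_dvd_left hpa _) h2
      have h6 := (h4.dvd_iff dvd_rfl).1 h5
      exact hp.one_lt.ne' (Nat.dvd_one.1 h6)
  · have hq : p ∈ P := Finset.mem_filter.2 ⟨hpP, hpa⟩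
    have h1 : p ∣ (∏ p ∈ P, p) * s.val := dvd_mul_of_dvd_left (Finset.dvd_prod_of_mem _ hq) _
    exact hpa ((Nat.dvd_add_left h1).1 hpd)

theorem lift_step1 {m : ℕ} {n : Type} [Fintype n] [DecidableEq n]
    (IH : ∀ D : Matrix n n (ZMod m), D.det = 1 → LiftsSL D)
    (A : Matrix (Unit ⊕ n) (Unit ⊕ n) (ZMod m)) (hA : A.det = 1)
    (h : A (Sum.inl ()) (Sum.inl ()) = 1) : LiftsSL A := by
  have h1 : A.toBlocks₁₁ = 1 := by
    ext i j
    simpa [Matrix.toBlocks₁₁] using h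
  rw [← Matrix.fromBlocks_toBlocks A, h1] at hA ⊢
  rw [Matrix.det_fromBlocks_one₁₁] at hA
  have := ((liftsSL_lower A.toBlocks₂₁).mul (liftsSL_diag (IH _ hA))).mul
    (liftsSL_upper A.toBlocks₁₂)
  rw [Matrix.fromBlocks_multiply, Matrix.fromBlocks_multiply] at this
  simpa using this

theorem lift_step2 {m : ℕ} {n : Type} [Fintype n] [DecidableEq n]
    (IH : ∀ D : Matrix n n (ZMod m), D.det = 1 → LiftsSL D)
    (A : Matrix (Unit ⊕ n) (Unit ⊕ n) (ZMod m)) (hA : A.det = 1) (i : n)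
    (h : A (Sum.inr i) (Sum.inl ()) = 1) : LiftsSL A := by
  apply liftsSL_of_upper (Matrix.of fun _ j => if j = i then 1 - A (Sum.inl ()) (Sum.inl ()) else 0)
  apply lift_step1 IH
  · simp [hA]
  · simp [Matrix.mul_apply, h]

theorem lift_step3 {m : ℕ} {n : Type} [Fintype n] [DecidableEq n]
    (IH : ∀ D : Matrix n n (ZMod m), D.det = 1 → LiftsSL D)
    (A : Matrix (Unit ⊕ n) (Unit ⊕ n) (ZMod m)) (hA : A.det = 1) (i : n)
    (h : IsUnit (A (Sum.inl ()) (Sum.inl ()))) : LiftsSL A := by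
  obtain ⟨u, hu⟩ := h.exists_left_inv
  apply liftsSL_of_lower (Matrix.of fun j _ => (1 - A (Sum.inr i) (Sum.inl ())) * u)
  apply lift_step2 IH _ _ i
  · simp [Matrix.mul_apply, Matrix.one_apply, mul_assoc, hu]
  · simp [hA]

theorem lift_step4 {m : ℕ} (hm : 1 ≤ m) {n : Type} [Fintype n] [DecidableEq n]
    (IH : ∀ D : Matrix n n (ZMod m), D.det = 1 → LiftsSL D)
    (A : Matrix (Unit ⊕ n) (Unit ⊕ n) (ZMod m)) (hA : A.det = 1) : LiftsSL A := by
  have h := congrFun (congrFun (Matrix.adjugate_mul A) (Sum.inl ())) (Sum.inl ())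
  rw [hA, one_smul, Matrix.one_apply_eq, Matrix.mul_apply, Fintype.sum_sum_type] at h
  simp only [Finset.univ_unique, Finset.sum_singleton, PUnit.default_eq_unit] at h
  rcases isEmpty_or_nonempty n with hn | ⟨⟨i⟩⟩
  · apply lift_step1 IH A hA
    have : Unique (Unit ⊕ n) := (Equiv.sumEmpty Unit n).unique
    rw [Matrix.det_unique] at hA
    rwa [Subsingleton.elim (Sum.inl ()) (default : Unit ⊕ n)]
  · rw [mul_comm] at h
    obtain ⟨x, hx⟩ := stable_rank_zmod hm _ _ _ h
    apply liftsSL_of_upper (Matrix.of fun _ j => x * A.adjugate (Sum.inl ()) (Sum.inr j))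
    apply lift_step3 IH _ _ i
    · simpa [Matrix.mul_apply, Finset.mul_sum, mul_assoc] using hx
    · simp [hA]

theorem lift_all {m : ℕ} (hm : 1 ≤ m) (r : ℕ) :
    ∀ A : Matrix (Fin r) (Fin r) (ZMod m), A.det = 1 → LiftsSL A := by
  induction r with
  | zero =>
    intro A _
    exact ⟨1, by simp, by ext i; exact i.elim0⟩
  | succ r ih =>
    intro A hA
    let e : Unit ⊕ Fin r ≃ Fin (r + 1) := Fintype.equivOfCardEq (by simp; omega)
    obtain ⟨B, hB, h⟩ := lift_step4 hm ih (A.submatrix e e) (by simp [hA])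
    refine ⟨B.submatrix e.symm e.symm, by simp [hB], ?_⟩
    ext i j
    have := congrFun (congrFun h (e.symm i)) (e.symm j)
    simpa using this

theorem mem_range_of_lift {r m : ℕ} (A : GL (Fin r) (ZMod m)) (B : Matrix (Fin r) (Fin r) ℤ)
    (hB : IsUnit B.det) (h : (Int.castRingHom (ZMod m)).mapMatrix B = A) :
    A ∈ Set.range (Units.map ((Int.castRingHom (ZMod m)).mapMatrix.toMonoidHom :
          Matrix (Fin r) (Fin r) ℤ →* Matrix (Fin r) (Fin r) (ZMod m)) :
        GL (Fin r) ℤ → GL (Fin r) (ZMod m)) := by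
  obtain ⟨U, hU⟩ := (Matrix.isUnit_iff_isUnit_det B).2 hB
  refine ⟨U, Units.ext ?_⟩
  rw [← h, ← hU]
  rfl

/-- For `r ≥ 1`, `m ≥ 1`, the image of the entrywise reduction map
`GL(r, ℤ) → GL(r, ℤ/m)` is exactly the set of matrices of determinant `1` or `-1`;
in particular it contains `SL(r, ℤ/m)` (the elements of determinant `1`). -/
theorem stmt6 (r m : ℕ) (hr : 1 ≤ r) (hm : 1 ≤ m) :
    (Set.range (Units.map ((Int.castRingHom (ZMod m)).mapMatrix.toMonoidHom :
          Matrix (Fin r) (Fin r) ℤ →* Matrix (Fin r) (Fin r) (ZMod m)) :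
        GL (Fin r) ℤ → GL (Fin r) (ZMod m)) =
      {A : GL (Fin r) (ZMod m) |
        (A : Matrix (Fin r) (Fin r) (ZMod m)).det = 1 ∨
        (A : Matrix (Fin r) (Fin r) (ZMod m)).det = -1}) ∧
    ∀ A : GL (Fin r) (ZMod m), (A : Matrix (Fin r) (Fin r) (ZMod m)).det = 1 →
      A ∈ Set.range (Units.map ((Int.castRingHom (ZMod m)).mapMatrix.toMonoidHom :
          Matrix (Fin r) (Fin r) ℤ →* Matrix (Fin r) (Fin r) (ZMod m)) :
        GL (Fin r) ℤ → GL (Fin r) (ZMod m)) := by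
  have key : ∀ A : GL (Fin r) (ZMod m), (A : Matrix (Fin r) (Fin r) (ZMod m)).det = 1 →
      A ∈ Set.range (Units.map ((Int.castRingHom (ZMod m)).mapMatrix.toMonoidHom :
          Matrix (Fin r) (Fin r) ℤ →* Matrix (Fin r) (Fin r) (ZMod m)) :
        GL (Fin r) ℤ → GL (Fin r) (ZMod m)) := by
    intro A hA
    obtain ⟨B, hB, h⟩ := lift_all hm r _ hA
    exact mem_range_of_lift A B (by simp [hB]) h
  refine ⟨?_, key⟩
  ext A
  constructor
  · rintro ⟨U, rfl⟩
    have hU : IsUnit (U : Matrix (Fin r) (Fin r) ℤ).det :=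
      (Matrix.isUnit_iff_isUnit_det _).1 U.isUnit
    have e : ((Int.castRingHom (ZMod m)).mapMatrix (U : Matrix (Fin r) (Fin r) ℤ)).det
        = (Int.castRingHom (ZMod m)) (U : Matrix (Fin r) (Fin r) ℤ).det :=
      (RingHom.map_det _ _).symm
    change ((Int.castRingHom (ZMod m)).mapMatrix (U : Matrix (Fin r) (Fin r) ℤ)).det = 1 ∨
      ((Int.castRingHom (ZMod m)).mapMatrix (U : Matrix (Fin r) (Fin r) ℤ)).det = -1
    rw [e]
    rcases Int.isUnit_iff.1 hU with h | h <;> simp [h]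
  · rintro (hA | hA)
    · exact key A hA
    · let d : Fin r → ℤ := fun i => if i = ⟨0, hr⟩ then -1 else 1
      have hd : (Matrix.diagonal d).det = -1 := by
        rw [Matrix.det_diagonal]
        simp [d, Finset.prod_ite_eq']
      have hdd : Matrix.diagonal d * Matrix.diagonal d = 1 := by
        rw [Matrix.diagonal_mul_diagonal, ← Matrix.diagonal_one]
        congr 1
        ext i
        by_cases hi : i = ⟨0, hr⟩ <;> simp [d, hi]
      let f := (Int.castRingHom (ZMod m)).mapMatrix (m := Fin r)
      have hfd : (f (Matrix.diagonal d)).det = -1 := by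
        have := (RingHom.map_det (Int.castRingHom (ZMod m)) (Matrix.diagonal d)).symm
        rw [hd] at this
        simpa [f] using this
      obtain ⟨B, hB, h⟩ := lift_all hm r ((A : Matrix (Fin r) (Fin r) (ZMod m)) *
        f (Matrix.diagonal d)) (by rw [Matrix.det_mul, hA, hfd]; simp)
      refine mem_range_of_lift A (B * Matrix.diagonal d) (by rw [Matrix.det_mul, hB, hd]; simp) ?_
      rw [map_mul, h, mul_assoc, ← map_mul, hdd, map_one, mul_one]
end

section
/- For every r ≥ 1 and every integer m > 2, the image of the reduction homomorphism GL(r, ℤ) → GL(r, ℤ/mℤ) is a subgroup of GL(r, ℤ/mℤ) of index φ(m)/2, where φ is the Euler totient function. -/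
open Matrix

lemma aux_smith {r : ℕ} (A : Matrix (Fin r) (Fin r) ℤ) (h : A.det ≠ 0) :
    ∃ (P Q : GL (Fin r) ℤ) (d : Fin r → ℤ),
      A * (Q : Matrix (Fin r) (Fin r) ℤ) = (P : Matrix (Fin r) (Fin r) ℤ) * diagonal d := by
  have hinj : Function.Injective A.mulVecLin := by
    rw [← LinearMap.ker_eq_bot, LinearMap.ker_eq_bot']
    intro v hv
    exact Matrix.eq_zero_of_mulVec_eq_zero h hv
  let e := LinearEquiv.ofInjective A.mulVecLin hinj
  obtain ⟨b, a, c, hc⟩ := Submodule.exists_smith_normal_form_of_rank_eq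
    (N := LinearMap.range A.mulVecLin) (Pi.basisFun ℤ (Fin r)) e.finrank_eq.symm
  let c' := c.map e.symm
  have hc' : ∀ i, A *ᵥ (c' i) = a i • b i := by
    intro i
    rw [← hc i]
    have : e (c' i) = c i := by simp [c']
    rw [← this]
    rfl
  let s := Pi.basisFun ℤ (Fin r)
  refine ⟨⟨s.toMatrix b, b.toMatrix s, s.toMatrix_mul_toMatrix_flip b,
    b.toMatrix_mul_toMatrix_flip s⟩, ⟨s.toMatrix c', c'.toMatrix s,
    s.toMatrix_mul_toMatrix_flip c', c'.toMatrix_mul_toMatrix_flip s⟩, a, ?_⟩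
  ext i j
  have := congrFun (hc' j) i
  simp only [Matrix.mul_diagonal]
  simp only [Matrix.mul_apply, Module.Basis.toMatrix_apply, s, Pi.basisFun_repr]
  simp only [Matrix.mulVec, dotProduct, Pi.smul_apply, smul_eq_mul] at this
  rw [this, mul_comm]

def auxDg (r : ℕ) (R : Type) [CommRing R] : (Fin r → Rˣ) →* GL (Fin r) R where
  toFun d := ⟨diagonal fun i => (d i : R), diagonal fun i => ((d i)⁻¹ : Rˣ),
    by simp [diagonal_mul_diagonal], by simp [diagonal_mul_diagonal]⟩
  map_one' := by ext; simp
  map_mul' x y := by ext1; simp [diagonal_mul_diagonal]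

lemma auxDg_coe (r : ℕ) (R : Type) [CommRing R] (d : Fin r → Rˣ) :
    (auxDg r R d : Matrix (Fin r) (Fin r) R) = diagonal fun i => (d i : R) := rfl

lemma auxDg_det (r : ℕ) (R : Type) [CommRing R] (d : Fin r → Rˣ) :
    Matrix.GeneralLinearGroup.det (auxDg r R d) = ∏ i, d i := by
  ext
  simp [auxDg_coe]

abbrev auxRed (r m : ℕ) : GL (Fin r) ℤ →* GL (Fin r) (ZMod m) :=
  (Units.map ((Int.castRingHom (ZMod m)).mapMatrix.toMonoidHom :
          Matrix (Fin r) (Fin r) ℤ →* Matrix (Fin r) (Fin r) (ZMod m)) :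
        GL (Fin r) ℤ →* GL (Fin r) (ZMod m))

lemma auxRed_apply (r m : ℕ) (g : GL (Fin r) ℤ) :
    (auxRed r m g : Matrix (Fin r) (Fin r) (ZMod m)) =
      (g : Matrix (Fin r) (Fin r) ℤ).map (Int.castRingHom (ZMod m)) := rfl

def auxBlk {r : ℕ} (i j : Fin r) (a b c d : ℤ) : Matrix (Fin r) (Fin r) ℤ :=
  1 + single i i (a - 1) + single i j b + single j i c + single j j (d - 1)

lemma auxBlk_mul {r : ℕ} {i j : Fin r} (hij : i ≠ j) (a b c d a' b' c' d' : ℤ) :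
    auxBlk i j a b c d * auxBlk i j a' b' c' d' =
      auxBlk i j (a * a' + b * c') (a * b' + b * d') (c * a' + d * c') (c * b' + d * d') := by
  simp only [auxBlk, mul_add, add_mul, one_mul, mul_one, single_mul_single_same,
    single_mul_single_of_ne _ _ _ _ hij, single_mul_single_of_ne _ _ _ _ hij.symm]
  ext x y
  simp only [Matrix.add_apply, single_apply, Matrix.zero_apply]
  split_ifs <;> ring

lemma aux_pair {r m : ℕ} {i j : Fin r} (hij : i ≠ j) (u : (ZMod m)ˣ) :
    auxDg r (ZMod m) (Pi.mulSingle i u * (Pi.mulSingle j u)⁻¹) ∈ (auxRed r m).range := by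
  obtain ⟨a, ha⟩ := ZMod.intCast_surjective (u : ZMod m)
  have hcop : IsCoprime a ((m : ℤ) * m) := by
    have : IsCoprime a (m : ℤ) := by
      obtain ⟨b, hb⟩ := ZMod.intCast_surjective ((u⁻¹ : (ZMod m)ˣ) : ZMod m)
      have h1 : ((a * b - 1 : ℤ) : ZMod m) = 0 := by
        push_cast
        rw [ha, hb]; simp
      rw [ZMod.intCast_zmod_eq_zero_iff_dvd] at h1
      obtain ⟨k, hk⟩ := h1
      exact ⟨b, -k, by linear_combination hk⟩
    exact this.mul_right this
  obtain ⟨b, k, hbk⟩ := hcop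
  have hb : ((b : ℤ) : ZMod m) = ((u⁻¹ : (ZMod m)ˣ) : ZMod m) := by
    have := congrArg (Int.cast : ℤ → ZMod m) hbk
    push_cast at this
    rw [ha] at this
    simp only [CharP.cast_eq_zero, mul_zero, add_zero] at this
    exact Units.eq_inv_of_mul_eq_one_left ((mul_comm _ _).trans this)
  have hone : auxBlk i j 1 0 0 1 = 1 := by simp [auxBlk]
  refine ⟨⟨auxBlk i j a m (-(k * m)) b, auxBlk i j b (-m) (k * m) a, ?_, ?_⟩, ?_⟩
  · rw [auxBlk_mul hij, ← hone]; congr 1 <;> first | ring1 | linear_combination hbk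
  · rw [auxBlk_mul hij, ← hone]; congr 1 <;> first | ring1 | linear_combination hbk
  · ext x y
    rw [auxRed_apply, auxDg_coe]
    simp only [Matrix.map_apply, auxBlk, Matrix.add_apply, Matrix.one_apply, single_apply,
      map_add, eq_intCast, Matrix.diagonal_apply, Pi.mul_apply, Pi.inv_apply]
    by_cases hxi : x = i
    · subst hxi
      by_cases hyx : y = x
      · subst hyx
        simp [hij, hij.symm, ha]
      · simp [hij, hij.symm, hyx, Ne.symm hyx]
    · by_cases hxj : x = j
      · subst hxj
        by_cases hyx : y = x
        · subst hyx
          simp [hij, hij.symm, hb]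
        · simp [hij, hij.symm, hyx, Ne.symm hyx]
      · simp [hxi, hxj, Ne.symm hxi, Ne.symm hxj]

lemma aux_diag {r m : ℕ} (hr : 1 ≤ r) (d : Fin r → (ZMod m)ˣ)
    (hd : ∏ i, d i ∈ Subgroup.zpowers (-1 : (ZMod m)ˣ)) :
    auxDg r (ZMod m) d ∈ (auxRed r m).range := by
  let z : Fin r := ⟨0, hr⟩
  have hdec : d = (∏ i, (Pi.mulSingle i (d i) * (Pi.mulSingle z (d i))⁻¹)) *
      Pi.mulSingle z (∏ i, d i) := by
    rw [Finset.prod_mul_distrib, Finset.univ_prod_mulSingle, Finset.prod_inv_distrib]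
    have : (Pi.mulSingle z (∏ i, d i) : Fin r → (ZMod m)ˣ) = ∏ i, Pi.mulSingle z (d i) :=
      map_prod (MonoidHom.mulSingle (fun _ : Fin r => (ZMod m)ˣ) z) _ _
    rw [this]; simp
  rw [hdec, ← Subgroup.mem_comap]
  refine mul_mem (prod_mem fun i _ => ?_) ?_
  · by_cases h : i = z
    · rw [h, mul_inv_cancel]; exact one_mem _
    · exact aux_pair h _
  · obtain ⟨k, hk⟩ := hd
    simp only at hk
    rw [← hk, Subgroup.mem_comap]
    refine ⟨auxDg r ℤ (Pi.mulSingle z ((-1) ^ k)), ?_⟩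
    have h1 : auxRed r m (auxDg r ℤ (Pi.mulSingle z (-1))) =
        auxDg r (ZMod m) (Pi.mulSingle z (-1)) := by
      ext x y
      rw [auxRed_apply, auxDg_coe, auxDg_coe]
      by_cases hxy : x = y
      · subst hxy
        by_cases hx : x = z
        · subst hx; simp
        · simp [hx]
      · simp [hxy]
    rw [Pi.mulSingle_zpow, Pi.mulSingle_zpow, map_zpow, map_zpow, map_zpow, h1]

lemma aux_range (r m : ℕ) (hr : 1 ≤ r) (hm : 2 < m) :
    (auxRed r m).range =
      (Subgroup.zpowers (-1 : (ZMod m)ˣ)).comap Matrix.GeneralLinearGroup.det := by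
  have : Fact (1 < m) := ⟨by omega⟩
  have hle : (auxRed r m).range ≤
      (Subgroup.zpowers (-1 : (ZMod m)ˣ)).comap Matrix.GeneralLinearGroup.det := by
    rintro _ ⟨g, rfl⟩
    rw [Subgroup.mem_comap]
    have h : Matrix.GeneralLinearGroup.det (auxRed r m g) =
        Units.map (Int.castRingHom (ZMod m)).toMonoidHom (Matrix.GeneralLinearGroup.det g) := by
      ext
      exact ((Int.castRingHom (ZMod m)).map_det _).symm
    rw [h]
    rcases Int.units_eq_one_or (Matrix.GeneralLinearGroup.det g) with h | h
    · rw [h, map_one]; exact one_mem _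
    · rw [h]
      convert Subgroup.mem_zpowers (-1 : (ZMod m)ˣ)
      ext; simp
  apply le_antisymm hle
  intro g hg
  let A : Matrix (Fin r) (Fin r) ℤ := fun i j => ((g : Matrix _ _ (ZMod m)) i j).cast
  have hA : (Int.castRingHom (ZMod m)).mapMatrix A = g := by
    ext i j
    change (((g : Matrix _ _ (ZMod m)) i j).cast : ℤ) = ((g : Matrix _ _ (ZMod m)) i j : ZMod m)
    simp
  have hdet : A.det ≠ 0 := by
    intro h0
    have h1 := (Int.castRingHom (ZMod m)).map_det A
    rw [hA, h0, map_zero] at h1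
    exact (Matrix.GeneralLinearGroup.det g).ne_zero h1.symm
  obtain ⟨P, Q, d, h⟩ := aux_smith A hdet
  have h2 := congrArg (Int.castRingHom (ZMod m)).mapMatrix h
  rw [map_mul, map_mul, hA] at h2
  have h3 : ((auxRed r m P)⁻¹ * g * auxRed r m Q : GL (Fin r) (ZMod m)) =
      diagonal (fun i => (d i : ZMod m)) := by
    rw [Units.val_mul, Units.val_mul, mul_assoc]
    erw [h2]
    rw [← mul_assoc]
    erw [Units.inv_mul (auxRed r m P)]
    rw [one_mul]
    simp [Matrix.diagonal_map]
  have hu : ∀ i, IsUnit (d i : ZMod m) := by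
    have := (Matrix.GeneralLinearGroup.det ((auxRed r m P)⁻¹ * g * auxRed r m Q)).isUnit
    rw [Matrix.GeneralLinearGroup.val_det_apply, h3, det_diagonal] at this
    intro i
    exact isUnit_of_dvd_unit (Finset.dvd_prod_of_mem (fun i => (d i : ZMod m)) (Finset.mem_univ i)) this
  choose u hu using hu
  have h4 : (auxRed r m P)⁻¹ * g * auxRed r m Q = auxDg r (ZMod m) u := by
    ext1
    rw [h3, auxDg_coe]; simp [hu]
  have hP : auxRed r m P ∈ (auxRed r m).range := ⟨P, rfl⟩
  have hQ : auxRed r m Q ∈ (auxRed r m).range := ⟨Q, rfl⟩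
  have h5 : auxDg r (ZMod m) u ∈ (auxRed r m).range := by
    apply aux_diag hr
    rw [← auxDg_det, ← h4, ← Subgroup.mem_comap]
    exact mul_mem (mul_mem (inv_mem (hle hP)) hg) (hle hQ)
  have h6 : g = auxRed r m P * auxDg r (ZMod m) u * (auxRed r m Q)⁻¹ := by
    rw [← h4]; group
  rw [h6]
  exact mul_mem (mul_mem hP h5) (inv_mem hQ)

/-- For `r ≥ 1` and `m > 2`, the image of the entrywise reduction map
`GL(r, ℤ) → GL(r, ℤ/m)` is a subgroup of index `φ(m) / 2`. -/
theorem stmt7 (r m : ℕ) (hr : 1 ≤ r) (hm : 2 < m) :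
    (MonoidHom.range (Units.map ((Int.castRingHom (ZMod m)).mapMatrix.toMonoidHom :
          Matrix (Fin r) (Fin r) ℤ →* Matrix (Fin r) (Fin r) (ZMod m)) :
        GL (Fin r) ℤ →* GL (Fin r) (ZMod m))).index = Nat.totient m / 2 := by
  have h := aux_range r m hr hm
  have : Fact (1 < m) := ⟨by omega⟩
  have : NeZero m := ⟨by omega⟩
  have hs : Function.Surjective
      (Matrix.GeneralLinearGroup.det : GL (Fin r) (ZMod m) →* (ZMod m)ˣ) := by
    intro u
    refine ⟨auxDg r (ZMod m) (Pi.mulSingle ⟨0, hr⟩ u), ?_⟩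
    rw [auxDg_det, Finset.prod_pi_mulSingle']
    simp
  rw [h, Subgroup.index_comap_of_surjective _ hs]
  have h1 := (Subgroup.zpowers (-1 : (ZMod m)ˣ)).index_mul_card
  have h2 : orderOf (-1 : (ZMod m)ˣ) = 2 := by
    rw [← orderOf_units, Units.val_neg, Units.val_one, orderOf_neg_one, ZMod.ringChar_zmod_n,
      if_neg (by omega)]
  rw [Nat.card_zpowers, h2, Nat.card_eq_fintype_card, ZMod.card_units_eq_totient] at h1
  omega
end

section
/- Let p be a prime, let Λ be a (not necessarily commutative) ring that is an algebra over the ring ℤ_p of p-adic integers and is finitely generated as a ℤ_p-module, and let M, N, K be finitely generated right Λ-modules. If M ⊕ K ≅ N ⊕ K as Λ-modules, then M ≅ N as Λ-modules. -/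
/-- Left stable range one. -/
def SR1 (R : Type*) [Ring R] : Prop :=
  ∀ x a b : R, x * a + b = 1 → ∃ t, IsUnit (a + t * b)

theorem isUnit_one_add_jac {R : Type*} [Ring R] {j : R} (hj : j ∈ Ring.jacobson R) :
    IsUnit (1 + j) := by
  have key : ∀ j ∈ Ring.jacobson R, ∃ z, z * (1 + j) = 1 := by
    intro j hj
    rw [← Ideal.jacobson_bot, Ideal.mem_jacobson_iff] at hj
    obtain ⟨z, hz⟩ := hj 1
    refine ⟨z, ?_⟩
    rw [Ideal.mem_bot, sub_eq_zero] at hz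
    rw [mul_one] at hz
    rw [mul_add, mul_one, add_comm, hz]
  obtain ⟨z, hz⟩ := key j hj
  have hz' : z = 1 + (-z * j) := by
    rw [← hz]; noncomm_ring
  obtain ⟨w, hw⟩ := key (-z * j) (Ideal.mul_mem_left _ _ hj)
  rw [← hz'] at hw
  have : w = 1 + j := left_inv_eq_right_inv hw hz
  subst this
  exact ⟨⟨_, z, hw, hz⟩, rfl⟩

theorem isUnit_of_mk_jac {R : Type*} [Ring R] {u : R}
    (hu : IsUnit (Ideal.Quotient.mk (Ring.jacobson R) u)) : IsUnit u := by
  obtain ⟨⟨_, v', h1, h2⟩, rfl⟩ := hu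
  obtain ⟨v, rfl⟩ := Ideal.Quotient.mk_surjective v'
  have e : ∀ y, Ideal.Quotient.mk (Ring.jacobson R) y = 1 → IsUnit y := by
    intro y hy
    have : y - 1 ∈ Ring.jacobson R := by
      rw [← Ideal.Quotient.eq_zero_iff_mem]; simp [hy]
    simpa using isUnit_one_add_jac this
  have a1 := e (u * v) (by simpa using h1)
  have a2 := e (v * u) (by simpa using h2)
  obtain ⟨y, hy⟩ := a1.exists_right_inv
  obtain ⟨z, hz⟩ := a2.exists_left_inv
  rw [mul_assoc] at hy
  rw [← mul_assoc] at hz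
  have := left_inv_eq_right_inv hz hy
  rw [← this] at hy
  exact ⟨⟨u, _, hy, hz⟩, rfl⟩

theorem SR1.of_quot_jac {R : Type*} [Ring R] (h : SR1 (R ⧸ Ring.jacobson R)) : SR1 R := by
  intro x a b hx
  obtain ⟨t', ht⟩ := h (Ideal.Quotient.mk _ x) (Ideal.Quotient.mk _ a) (Ideal.Quotient.mk _ b)
    (by rw [← map_mul, ← map_add, hx, map_one])
  obtain ⟨t, rfl⟩ := Ideal.Quotient.mk_surjective t'
  exact ⟨t, isUnit_of_mk_jac (by simpa using ht)⟩

theorem split_equiv {R M : Type*} [Ring R] [AddCommGroup M] [Module R M] [IsSemisimpleModule R M]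
    (N : Submodule R M) : Nonempty (M ≃ₗ[R] (N × (M ⧸ N))) := by
  obtain ⟨C, hC⟩ := exists_isCompl N
  exact ⟨(Submodule.prodEquivOfIsCompl N C hC).symm.trans
    (LinearEquiv.prodCongr (LinearEquiv.refl _ _) (Submodule.quotientEquivOfIsCompl N C hC).symm)⟩

theorem exists_hom {R : Type*} [Ring R] [IsSemisimpleRing R] [Finite R] (f : R →ₗ[R] R)
    (hf : LinearMap.range f ≠ ⊤) :
    ∃ g : LinearMap.ker f →ₗ[R] (R ⧸ LinearMap.range f), g ≠ 0 := by
  by_contra! hcon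
  obtain ⟨e1⟩ := split_equiv (LinearMap.ker f)
  obtain ⟨e2⟩ := split_equiv (LinearMap.range f)
  let Y := R ⧸ LinearMap.range f
  have finY : Finite Y := Finite.of_surjective _ (Submodule.Quotient.mk_surjective _)
  have fin : ∀ (A : Type _) [AddCommGroup A] [Module R A] [Finite A], Finite (A →ₗ[R] Y) :=
    fun A _ _ _ => Finite.of_injective _ DFunLike.coe_injective
  have c1 : Nat.card (R →ₗ[R] Y) =
      Nat.card (LinearMap.ker f →ₗ[R] Y) * Nat.card (LinearMap.range f →ₗ[R] Y) := by
    rw [← Nat.card_prod]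
    refine Nat.card_congr (Equiv.trans ?_ (LinearMap.coprodEquiv ℕ).symm.toEquiv)
    exact (LinearEquiv.congrLeft Y ℕ (e1.trans
      (LinearEquiv.prodCongr (LinearEquiv.refl _ _) f.quotKerEquivRange))).toEquiv
  have c2 : Nat.card (R →ₗ[R] Y) =
      Nat.card (LinearMap.range f →ₗ[R] Y) * Nat.card (Y →ₗ[R] Y) := by
    rw [← Nat.card_prod]
    refine Nat.card_congr (Equiv.trans ?_ (LinearMap.coprodEquiv ℕ).symm.toEquiv)
    exact (LinearEquiv.congrLeft Y ℕ e2).toEquiv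
  have f1 := fin (LinearMap.range f)
  have f2 := fin Y
  have : Nat.card (LinearMap.ker f →ₗ[R] Y) = 1 := by
    rw [Nat.card_eq_one_iff_unique]
    exact ⟨⟨fun a b => (hcon a).trans (hcon b).symm⟩, ⟨0⟩⟩
  rw [c2, this, one_mul] at c1
  have pos : 0 < Nat.card (LinearMap.range f →ₗ[R] Y) := Nat.card_pos
  have h1 : Nat.card (Y →ₗ[R] Y) = 1 := by
    apply Nat.eq_of_mul_eq_mul_left pos
    rw [c1, mul_one]
  rw [Nat.card_eq_one_iff_unique] at h1
  have := h1.1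
  have h0 : (LinearMap.id : Y →ₗ[R] Y) = 0 := Subsingleton.elim _ _
  apply hf
  rw [eq_top_iff]
  intro y _
  rw [← Submodule.Quotient.mk_eq_zero]
  exact LinearMap.congr_fun h0 (Submodule.Quotient.mk y)

theorem exists_bigger {R : Type*} [Ring R] [IsSemisimpleRing R] [Finite R] (f g : R →ₗ[R] R)
    (hf : LinearMap.range f ≠ ⊤) (hfg : LinearMap.range f ⊔ LinearMap.range g = ⊤) :
    ∃ s : R →ₗ[R] R, LinearMap.range f < LinearMap.range (f + g ∘ₗ s) := by
  obtain ⟨φ, hφ⟩ := exists_hom f hf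
  obtain ⟨C, hC⟩ := exists_isCompl (LinearMap.ker f)
  let q : R →ₗ[R] R ⧸ LinearMap.range f := (LinearMap.range f).mkQ ∘ₗ g
  have hq : Function.Surjective q := by
    intro y
    obtain ⟨y, rfl⟩ := Submodule.Quotient.mk_surjective _ y
    have : y ∈ LinearMap.range f ⊔ LinearMap.range g := hfg ▸ Submodule.mem_top
    obtain ⟨_, ⟨u, rfl⟩, _, ⟨v, rfl⟩, rfl⟩ := Submodule.mem_sup.1 this
    refine ⟨v, ?_⟩
    simp [q]
  let pr := Submodule.projectionOnto _ _ hC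
  obtain ⟨s, hs⟩ := Module.projective_lifting_property q (φ ∘ₗ pr) hq
  refine ⟨s ∘ₗ (LinearMap.ker f).subtype ∘ₗ pr, ?_⟩
  have le : LinearMap.range f ≤ LinearMap.range (f + g ∘ₗ (s ∘ₗ (LinearMap.ker f).subtype ∘ₗ pr)) := by
    rintro _ ⟨r, rfl⟩
    refine ⟨r - (pr r : R), ?_⟩
    have h1 : f (pr r : R) = 0 := (pr r).2
    have h2 : pr (pr r : R) = pr r := Submodule.projectionOnto_apply_left hC _
    simp [h1, h2]
  refine lt_of_le_of_ne le ?_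
  intro heq
  apply hφ
  ext k
  have h1 : f (k : R) = 0 := k.2
  have h2 : pr (k : R) = k := Submodule.projectionOnto_apply_left hC _
  have h3 : g (s k) ∈ LinearMap.range f := by
    rw [heq]
    exact ⟨k, by simp [h1, h2]⟩
  have h4 := LinearMap.congr_fun hs k
  simp only [LinearMap.comp_apply, h2] at h4
  rw [← h4]
  simpa [q] using h3

theorem SR1.of_semisimple {R : Type*} [Ring R] [IsSemisimpleRing R] [Finite R] : SR1 R := by
  intro x a b hx
  let g : R →ₗ[R] R := LinearMap.toSpanSingleton R R b
  let F : R → (R →ₗ[R] R) := fun t => LinearMap.toSpanSingleton R R (a + t * b)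
  obtain ⟨t, ht⟩ := Finite.exists_max (fun t => Nat.card (LinearMap.range (F t)))
  have key : LinearMap.range (F t) = ⊤ := by
    by_contra hne
    obtain ⟨s, hs⟩ := exists_bigger (F t) g hne (by
      rw [eq_top_iff]
      intro y _
      have : y = (F t) (y * x) + g (y - y * x * t) := by
        simp only [F, g, LinearMap.toSpanSingleton_apply, smul_eq_mul]
        calc y = y * (x * a + b) := by rw [hx, mul_one]
          _ = _ := by noncomm_ring
      rw [this]
      exact Submodule.add_mem_sup ⟨_, rfl⟩ ⟨_, rfl⟩)
    have e : F t + g ∘ₗ s = F (t + s 1) := by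
      ext
      simp [F, g, add_mul, add_assoc]
    rw [e] at hs
    have := ht (t + s 1)
    have h2 := Set.ncard_lt_ncard (SetLike.coe_ssubset_coe.2 hs) (Set.toFinite _)
    exact absurd h2 (not_lt.2 this)
  have h1 : (1 : R) ∈ LinearMap.range (F t) := key ▸ Submodule.mem_top
  obtain ⟨v, hv⟩ := h1
  refine ⟨t, ?_⟩
  have hv' : v * (a + t * b) = 1 := by simpa [F] using hv
  exact IsUnit.of_mul_eq_one_right _ hv'

theorem SR1.of_finite {R : Type*} [Ring R] [Finite R] : SR1 R := by
  have : Finite (R ⧸ Ring.jacobson R) := Finite.of_surjective _ Ideal.Quotient.mk_surjective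
  exact SR1.of_quot_jac SR1.of_semisimple

theorem p_mem_jac (p : ℕ) [Fact p.Prime] (E : Type*) [Ring E] [Algebra ℤ_[p] E]
    [Module.Finite ℤ_[p] E] : (p : E) ∈ Ring.jacobson E := by
  rw [← Ideal.jacobson_bot, Ideal.mem_jacobson_iff]
  intro y
  let N : Submodule ℤ_[p] E := LinearMap.range (LinearMap.mulRight ℤ_[p] (y * p + 1))
  have hN : (⊤ : Submodule ℤ_[p] E) ≤ N := by
    apply Submodule.le_of_le_smul_of_le_jacobson_bot (I := IsLocalRing.maximalIdeal ℤ_[p])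
      Module.Finite.fg_top (IsLocalRing.jacobson_eq_maximalIdeal _ bot_ne_top).ge
    intro e _
    have : e = e * (y * p + 1) + (p : ℤ_[p]) • (-(e * y)) := by
      rw [Algebra.smul_def, map_natCast, (Nat.cast_commute p _).eq]
      noncomm_ring
    rw [this]
    refine Submodule.add_mem_sup ⟨e, rfl⟩ (Submodule.smul_mem_smul ?_ Submodule.mem_top)
    rw [PadicInt.maximalIdeal_eq_span_p]
    exact Ideal.mem_span_singleton_self _
  obtain ⟨z, hz⟩ := hN (Submodule.mem_top (x := (1 : E)))
  refine ⟨z, ?_⟩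
  rw [Ideal.mem_bot, sub_eq_zero, ← hz]
  simp [mul_add, mul_assoc]

theorem finite_of_p (p : ℕ) [Fact p.Prime] (S : Type*) [Ring S] [Algebra ℤ_[p] S]
    [Module.Finite ℤ_[p] S] (hp : (p : S) = 0) : Finite S := by
  obtain ⟨n, f, hf⟩ := Module.Finite.exists_fin' ℤ_[p] S
  refine Finite.of_surjective (fun c : Fin n → Fin p => f (fun i => ((c i : ℕ) : ℤ_[p]))) ?_
  intro s
  obtain ⟨v, rfl⟩ := hf s
  refine ⟨fun i => ⟨(v i).zmodRepr, (v i).zmodRepr_lt_p⟩, ?_⟩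
  have h : ∀ i, ∃ w, v i - ((v i).zmodRepr : ℤ_[p]) = p * w := by
    intro i
    have := (v i).sub_zmodRepr_mem
    rw [PadicInt.maximalIdeal_eq_span_p, Ideal.mem_span_singleton] at this
    exact this
  choose w hw using h
  have : v = (fun i => ((v i).zmodRepr : ℤ_[p])) + (p : ℤ_[p]) • w := by
    ext1 i
    simp [← hw]
  conv_rhs => rw [this, map_add, map_smul, Algebra.smul_def, map_natCast, hp, zero_mul, add_zero]

theorem SR1.of_padic (p : ℕ) [Fact p.Prime] (E : Type*) [Ring E] [Algebra ℤ_[p] E]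
    [Module.Finite ℤ_[p] E] : SR1 E := by
  apply SR1.of_quot_jac
  have : Module.Finite ℤ_[p] (E ⧸ Ring.jacobson E) :=
    Module.Finite.of_surjective (Ideal.Quotient.mkₐ ℤ_[p] (Ring.jacobson E)).toLinearMap
      Ideal.Quotient.mk_surjective
  have : Finite (E ⧸ Ring.jacobson E) := by
    apply finite_of_p p
    rw [← map_natCast (Ideal.Quotient.mk (Ring.jacobson E)), Ideal.Quotient.eq_zero_iff_mem]
    exact p_mem_jac p E
  exact SR1.of_finite

theorem SR1_end (p : ℕ) [Fact p.Prime] (A : Type*) [Ring A] [Algebra ℤ_[p] A]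
    [Module.Finite ℤ_[p] A] (K : Type*) [AddCommGroup K] [Module A K] [Module.Finite A K] :
    SR1 (Module.End A K) := by
  let : Module ℤ_[p] K := Module.compHom K (algebraMap ℤ_[p] A)
  have : IsScalarTower ℤ_[p] A K := ⟨fun r a k => by
    rw [Algebra.smul_def, mul_smul]; rfl⟩
  have : SMulCommClass A ℤ_[p] K := IsScalarTower.to_smulCommClass'
  have : Module.Finite ℤ_[p] K := Module.Finite.trans A K
  obtain ⟨n, f, hf⟩ := Module.Finite.exists_fin' ℤ_[p] K
  let G : Module.End A K →ₗ[ℤ_[p]] (Fin n → K) :=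
    { toFun := fun φ i => φ (f (Pi.single i 1))
      map_add' := fun _ _ => rfl
      map_smul' := fun _ _ => rfl }
  have hG : Function.Injective G := by
    intro φ ψ h
    have : (φ.restrictScalars ℤ_[p]) ∘ₗ f = (ψ.restrictScalars ℤ_[p]) ∘ₗ f := by
      apply LinearMap.pi_ext'
      intro i
      ext
      exact congrFun h i
    ext k
    obtain ⟨v, rfl⟩ := hf k
    exact LinearMap.congr_fun this v
  have : Module.Finite ℤ_[p] (Module.End A K) := Module.Finite.of_injective G hG
  exact SR1.of_padic p _

theorem cancel_of_unit {A M N K : Type*} [Ring A] [AddCommGroup M] [Module A M]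
    [AddCommGroup N] [Module A N] [AddCommGroup K] [Module A K]
    (φ : (M × K) ≃ₗ[A] (N × K)) (d : K ≃ₗ[A] K) (hd : ∀ k, (φ (0, k)).2 = d k) :
    Nonempty (M ≃ₗ[A] N) := by
  let c : M →ₗ[A] K := LinearMap.snd A N K ∘ₗ φ.toLinearMap ∘ₗ LinearMap.inl A M K
  let j : M →ₗ[A] M × K := LinearMap.prod LinearMap.id (-(d.symm.toLinearMap ∘ₗ c))
  let g : M →ₗ[A] N := LinearMap.fst A N K ∘ₗ φ.toLinearMap ∘ₗ j
  have h2 : ∀ m k, (φ (m, k)).2 = c m + d k := by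
    intro m k
    have : ((m, k) : M × K) = (m, 0) + (0, k) := by simp
    rw [this, map_add, Prod.snd_add, hd]
    rfl
  have hj : ∀ m, (φ (j m)).2 = 0 := by
    intro m
    have : j m = (m, -(d.symm (c m))) := rfl
    rw [this, h2]; simp
  refine ⟨LinearEquiv.ofBijective g ⟨?_, ?_⟩⟩
  · rw [← LinearMap.ker_eq_bot, LinearMap.ker_eq_bot']
    intro m hm
    have : φ (j m) = 0 := Prod.ext hm (hj m)
    rw [LinearEquiv.map_eq_zero_iff] at this
    exact congrArg Prod.fst this
  · intro n
    obtain ⟨⟨m, k⟩, hmk⟩ := φ.surjective (n, 0)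
    have h3 := h2 m k
    rw [hmk] at h3
    have hk : k = -(d.symm (c m)) := by
      rw [← map_neg, LinearEquiv.eq_symm_apply]
      exact (neg_eq_of_add_eq_zero_right h3.symm).symm
    refine ⟨m, ?_⟩
    have : j m = (m, k) := by rw [hk]; rfl
    change (φ (j m)).1 = n
    rw [this, hmk]

theorem cancel_of_SR1 {A M N K : Type*} [Ring A] [AddCommGroup M] [Module A M]
    [AddCommGroup N] [Module A N] [AddCommGroup K] [Module A K] (hK : SR1 (Module.End A K))
    (φ : (M × K) ≃ₗ[A] (N × K)) : Nonempty (M ≃ₗ[A] N) := by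
  let a : Module.End A K := LinearMap.snd A N K ∘ₗ φ.toLinearMap ∘ₗ LinearMap.inr A M K
  let u : K →ₗ[A] N := LinearMap.fst A N K ∘ₗ φ.toLinearMap ∘ₗ LinearMap.inr A M K
  let x : Module.End A K := LinearMap.snd A M K ∘ₗ φ.symm.toLinearMap ∘ₗ LinearMap.inr A N K
  let v : N →ₗ[A] K := LinearMap.snd A M K ∘ₗ φ.symm.toLinearMap ∘ₗ LinearMap.inl A N K
  have h : x * a + v ∘ₗ u = 1 := by
    ext k
    change (φ.symm (0, (φ (0, k)).2)).2 + (φ.symm ((φ (0, k)).1, 0)).2 = k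
    rw [← Prod.snd_add, ← map_add]
    simp
  obtain ⟨t, ht⟩ := hK x a (v ∘ₗ u) h
  let w : N →ₗ[A] K := t ∘ₗ v
  let sh : (N × K) ≃ₗ[A] (N × K) :=
    LinearEquiv.ofLinearMap
      (LinearMap.prod (LinearMap.fst A N K) (LinearMap.snd A N K + w ∘ₗ LinearMap.fst A N K))
      (LinearMap.prod (LinearMap.fst A N K) (LinearMap.snd A N K - w ∘ₗ LinearMap.fst A N K))
      (by ext <;> simp) (by ext <;> simp)
  rw [Module.End.isUnit_iff] at ht
  exact cancel_of_unit (φ.trans sh) (LinearEquiv.ofBijective _ ht) (fun k => rfl)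


/-- Let `p` be a prime and `Λ` a ring that is an algebra over the `p`-adic
integers `ℤ_[p]`, finitely generated as a `ℤ_[p]`-module. For finitely generated right
`Λ`-modules (i.e. `Λᵐᵒᵖ`-modules) `M, N, K`, if `M ⊕ K ≅ N ⊕ K` then `M ≅ N`
(the cancellation law). -/
theorem stmt9 (p : ℕ) [Fact p.Prime] (Λ : Type*) [Ring Λ] [Algebra ℤ_[p] Λ]
    [Module.Finite ℤ_[p] Λ]
    (M N K : Type*) [AddCommGroup M] [Module Λᵐᵒᵖ M] [Module.Finite Λᵐᵒᵖ M]
    [AddCommGroup N] [Module Λᵐᵒᵖ N] [Module.Finite Λᵐᵒᵖ N]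
    [AddCommGroup K] [Module Λᵐᵒᵖ K] [Module.Finite Λᵐᵒᵖ K]
    (h : Nonempty ((M × K) ≃ₗ[Λᵐᵒᵖ] (N × K))) :
    Nonempty (M ≃ₗ[Λᵐᵒᵖ] N) := by
  obtain ⟨φ⟩ := h
  have : Module.Finite ℤ_[p] Λᵐᵒᵖ :=
    Module.Finite.equiv (MulOpposite.opLinearEquiv ℤ_[p] (M := Λ))
  exact cancel_of_SR1 (SR1_end p Λᵐᵒᵖ K) φ
end

section
/- Let Λ be a nonzero ring whose additive group is a finitely generated abelian group. Then every maximal right ideal M of Λ contains pΛ for some prime number p. -/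
theorem stmt10_step {Λ : Type*} [Ring Λ] (M : Submodule Λᵐᵒᵖ Λ) (hM : IsCoatom M) (p : ℕ)
    (hp : ¬ ∀ l : Λ, (p : Λ) * l ∈ M) (l : Λ) : ∃ l' : Λ, ∃ m ∈ M, l = (p : Λ) * l' + m := by
  let N : Submodule Λᵐᵒᵖ Λ :=
    { carrier := {x | ∃ l' : Λ, ∃ m ∈ M, x = (p : Λ) * l' + m}
      add_mem' := by
        rintro a b ⟨x, m, hm, rfl⟩ ⟨y, m', hm', rfl⟩
        exact ⟨x + y, m + m', M.add_mem hm hm', by rw [mul_add]; abel⟩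
      zero_mem' := ⟨0, 0, M.zero_mem, by simp⟩
      smul_mem' := by
        rintro c a ⟨x, m, hm, rfl⟩
        refine ⟨c • x, c • m, M.smul_mem c hm, ?_⟩
        rw [smul_add, mul_smul_comm] }
  have hN : N = ⊤ := by
    apply hM.2
    refine lt_of_le_of_ne (fun m hm => ⟨0, m, hm, by simp⟩) ?_
    intro h
    apply hp
    intro l
    rw [h]
    exact ⟨l, 0, M.zero_mem, by simp⟩
  have : l ∈ N := hN ▸ Submodule.mem_top
  exact this

theorem stmt10_desc {Λ : Type*} [Ring Λ] (M : Submodule Λᵐᵒᵖ Λ) (hM : IsCoatom M)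
    (H : ∀ p : ℕ, p.Prime → ¬ ∀ l : Λ, (p : Λ) * l ∈ M) (n : ℕ) (hn : n ≠ 0)
    (h : ∀ l : Λ, (n : Λ) * l ∈ M) : False := by
  induction n using Nat.strong_induction_on with
  | _ n ih =>
    by_cases h1 : n = 1
    · apply hM.1
      rw [eq_top_iff]
      intro x _
      simpa [h1] using h x
    · obtain ⟨p, hp, a, rfl⟩ := Nat.exists_prime_and_dvd h1
      have ha : a ≠ 0 := by rintro rfl; simp at hn
      refine ih a ?_ ha ?_
      · have := hp.two_le
        have := Nat.pos_of_ne_zero ha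
        nlinarith
      · intro l
        obtain ⟨l', m, hm, rfl⟩ := stmt10_step M hM p (H p hp) l
        rw [mul_add]
        refine M.add_mem ?_ ?_
        · rw [← mul_assoc, ← Nat.cast_mul, mul_comm a p]
          exact h l'
        · rw [← nsmul_eq_mul]
          exact M.toAddSubmonoid.nsmul_mem hm a

/-- Let `Λ` be a nonzero ring whose additive group is finitely generated.
Then every maximal right ideal `M` of `Λ` (a coatom among `Λᵐᵒᵖ`-submodules of `Λ`, i.e.
right ideals) contains `pΛ` for some prime `p`. -/
theorem stmt10 (Λ : Type*) [Ring Λ] [Nontrivial Λ] (hfg : AddGroup.FG Λ)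
    (M : Submodule Λᵐᵒᵖ Λ) (hM : IsCoatom M) :
    ∃ p : ℕ, p.Prime ∧ ∀ l : Λ, (p : Λ) * l ∈ M := by
  by_contra! hc
  have H : ∀ p : ℕ, p.Prime → ¬ ∀ l : Λ, (p : Λ) * l ∈ M := by
    intro p hp h
    obtain ⟨l, hl⟩ := hc p hp
    exact hl (h l)
  haveI : Module.Finite ℤ Λ := Module.Finite.iff_addGroup_fg.2 hfg
  let K : Submodule ℤ Λ := AddSubgroup.toIntSubmodule M.toAddSubgroup
  obtain ⟨r, hr, hr0⟩ := Submodule.exists_sub_one_mem_and_smul_eq_zero_of_fg_of_le_smul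
    (Ideal.span {(2 : ℤ)}) (⊤ : Submodule ℤ (Λ ⧸ K)) Module.Finite.fg_top (by
      intro x _
      obtain ⟨l, rfl⟩ := K.mkQ_surjective x
      obtain ⟨l', m, hm, rfl⟩ := stmt10_step M hM 2 (H 2 Nat.prime_two) l
      have h0 : K.mkQ m = 0 := by
        rw [Submodule.mkQ_apply, Submodule.Quotient.mk_eq_zero]; exact hm
      have h2 : ((2 : ℕ) : Λ) * l' = (2 : ℤ) • l' := by simp
      rw [map_add, h0, add_zero, h2, map_smul]
      exact Submodule.smul_mem_smul (Ideal.mem_span_singleton_self _) Submodule.mem_top)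
  have hrne : r ≠ 0 := by
    rintro rfl
    rw [Ideal.mem_span_singleton] at hr
    omega
  refine stmt10_desc M hM H r.natAbs (by simpa using hrne) ?_
  intro l
  have h1 : r • l ∈ M := by
    have := hr0 (K.mkQ l) Submodule.mem_top
    rw [← map_smul, Submodule.mkQ_apply, Submodule.Quotient.mk_eq_zero] at this
    exact this
  rw [← nsmul_eq_mul, ← natCast_zsmul]
  rcases Int.natAbs_eq r with h | h
  · rw [← h]; exact h1
  · have h' : ((r.natAbs : ℕ) : ℤ) = -r := by omega
    rw [h', neg_smul]
    exact M.neg_mem h1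
end
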